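/- arXiv:1303.1271 — 5 statements merged into one kernel-verified Lean document; each statement's English description precedes it below -/
import Mathlib

section
/- Let n ≥ 1, let A ⊆ ℝ^n be a nonempty compact convex set, let B be a nonempty finite set, and let G : ℝ^n → B → ℝ be such that for every y ∈ B the function α ↦ G(α, y) is continuous on A and concave on A. Then sup_{α ∈ A} min_{y ∈ B} G(α, y) = min_{μ ∈ Δ_B} sup_{α ∈ A} Σ_{y ∈ B} μ(y)·G(α, y), where both the minimum over B and the minimum over Δ_B are attained. (This is Proposition 1 of the paper: the max–min problem over label assignments equals the minimization over convex combinations of the per-label objectives.) -/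
/-- Proposition 1: for a nonempty compact convex `A ⊆ ℝⁿ`, a nonempty finite label
set `B`, and `G` continuous and concave in `α` for each label `y`, the max–min value
`sup_{α∈A} min_{y∈B} G(α,y)` equals the minimum over the simplex `Δ_B` of
`sup_{α∈A} Σ_y μ(y)·G(α,y)`, and this minimum is attained. -/
theorem maxmin_eq_min_over_simplex
    {n : ℕ} (hn : 1 ≤ n)
    (A : Set (EuclideanSpace ℝ (Fin n))) (hA : A.Nonempty)
    (hAcomp : IsCompact A) (hAconv : Convex ℝ A)
    (B : Type*) [Fintype B] [Nonempty B]
    (G : EuclideanSpace ℝ (Fin n) → B → ℝ)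
    (hcont : ∀ y : B, ContinuousOn (fun α => G α y) A)
    (hconc : ∀ y : B, ConcaveOn ℝ A (fun α => G α y)) :
    ∃ μ : B → ℝ, (∀ y, 0 ≤ μ y) ∧ (∑ y, μ y = 1) ∧
      sSup ((fun α => Finset.univ.inf' Finset.univ_nonempty (G α)) '' A) =
        sSup ((fun α => ∑ y, μ y * G α y) '' A) ∧
      ∀ ν : B → ℝ, (∀ y, 0 ≤ ν y) → (∑ y, ν y = 1) →
        sSup ((fun α => ∑ y, μ y * G α y) '' A) ≤
          sSup ((fun α => ∑ y, ν y * G α y) '' A) := by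
  classical
  have hFc : ∀ μ : B → ℝ, ContinuousOn (fun α => ∑ y, μ y * G α y) A := fun μ =>
    continuousOn_finset_sum _ fun y _ => continuousOn_const.mul (hcont y)
  have hbdd : ∀ μ : B → ℝ, BddAbove ((fun α => ∑ y, μ y * G α y) '' A) := fun μ =>
    hAcomp.bddAbove_image (hFc μ)
  have hFconc : ∀ μ ∈ stdSimplex ℝ B, ConcaveOn ℝ A (fun α => ∑ y, μ y * G α y) := by
    intro μ hμ
    refine ⟨hAconv, fun x hx z hz a b ha hb hab => ?_⟩
    simp only [smul_eq_mul, Finset.mul_sum, ← Finset.sum_add_distrib]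
    refine Finset.sum_le_sum fun y _ => ?_
    have h := mul_le_mul_of_nonneg_left ((hconc y).2 hx hz ha hb hab) (hμ.1 y)
    simp only [smul_eq_mul] at h
    linarith
  have hFconv : ∀ α ∈ A, ConvexOn ℝ (stdSimplex ℝ B)
      (fun μ : B → ℝ => ∑ y, μ y * G α y) := by
    intro α _
    refine ⟨convex_stdSimplex ℝ B, fun x _ z _ a b _ _ _ => le_of_eq ?_⟩
    simp only [smul_eq_mul, Finset.mul_sum, ← Finset.sum_add_distrib, Pi.add_apply,
      Pi.smul_apply]
    exact Finset.sum_congr rfl fun y _ => by ring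
  have hne : (stdSimplex ℝ B).Nonempty :=
    ⟨_, single_mem_stdSimplex ℝ (Classical.arbitrary B)⟩
  obtain ⟨μ, hμ, b, hb, hs⟩ := Sion.exists_isSaddlePointOn
    (X := stdSimplex ℝ B) (Y := A) (f := fun μ α => ∑ y, μ y * G α y)
    hne (convex_stdSimplex ℝ B) (isCompact_stdSimplex ℝ B)
    (fun α _ => Continuous.lowerSemicontinuous (by fun_prop) |>.lowerSemicontinuousOn _)
    (fun α hα => (hFconv α hα).quasiconvexOn)
    hAconv hA hAcomp
    (fun μ _ => (hFc μ).upperSemicontinuousOn)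
    (fun μ hμ => (hFconc μ hμ).quasiconcaveOn)
  have hle : ∀ ν ∈ stdSimplex ℝ B, ∀ α,
      Finset.univ.inf' Finset.univ_nonempty (G α) ≤ ∑ y, ν y * G α y := by
    intro ν hν α
    calc Finset.univ.inf' Finset.univ_nonempty (G α)
        = ∑ y, ν y * Finset.univ.inf' Finset.univ_nonempty (G α) := by
          rw [← Finset.sum_mul, hν.2, one_mul]
      _ ≤ _ := Finset.sum_le_sum fun y hy =>
          mul_le_mul_of_nonneg_left (Finset.inf'_le _ hy) (hν.1 y)
  refine ⟨μ, hμ.1, hμ.2, le_antisymm ?_ ?_, ?_⟩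
  · refine csSup_le (hA.image _) ?_
    rintro _ ⟨α, hα, rfl⟩
    exact (hle μ hμ α).trans (le_csSup (hbdd μ) ⟨α, hα, rfl⟩)
  · refine csSup_le (hA.image _) ?_
    rintro _ ⟨α, hα, rfl⟩
    have hbd : BddAbove ((fun α => Finset.univ.inf' Finset.univ_nonempty (G α)) '' A) := by
      obtain ⟨M, hM⟩ := hbdd μ
      refine ⟨M, ?_⟩
      rintro _ ⟨β, hβ, rfl⟩
      exact (hle μ hμ β).trans (hM ⟨β, hβ, rfl⟩)
    refine le_trans ?_ (le_csSup hbd ⟨b, hb, rfl⟩)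
    refine Finset.le_inf' _ _ fun y _ => ?_
    have h := hs _ (single_mem_stdSimplex ℝ y) α hα
    simpa [Pi.single_apply] using h
  · intro ν h0 h1
    refine csSup_le (hA.image _) ?_
    rintro _ ⟨α, hα, rfl⟩
    exact (hs ν ⟨h0, h1⟩ α hα).trans (le_csSup (hbdd ν) ⟨b, hb, rfl⟩)
end

section
/- Let A ⊆ ℝ^n be a nonempty compact convex set, let λ > 0, M ≥ 0, ε > 0, let I be an index set, and let (g_y)_{y∈I} be functions ℝ^n → ℝ such that each g_y is λ-strongly convex on A and M-Lipschitz on A. For a nonempty finite C ⊆ I define J_C(α, μ) = Σ_{y∈C} μ(y) g_y(α) for α ∈ ℝ^n, μ ∈ Δ_C, and define p(C) = − max_{μ ∈ Δ_C} min_{α ∈ A} J_C(α, μ). Suppose (ᾱ, μ̄) ∈ A × Δ_C is a saddle point of J_C, i.e., J_C(α, μ̄) ≥ J_C(ᾱ, μ̄) ≥ J_C(ᾱ, μ) for all α ∈ A and μ ∈ Δ_C (so p(C) = −J_C(ᾱ, μ̄)), and suppose y₀ ∈ I satisfies g_{y₀}(ᾱ) ≥ max_{y ∈ C} g_y(ᾱ)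 + ε. Then p(C ∪ {y₀}) ≤ p(C) − η, where η = ((−c + √(c² + 4ε))/2)² and c = M√(2/λ). (This is Theorem 2 of the paper: each cutting-plane iteration that adds an ε-violated label decreases the optimal objective value by at least η.) -/
/-- Theorem 2: each cutting-plane iteration that adds an ε-violated label `y₀` to the
working set `C` decreases the optimal objective value `p` by at least
`η = ((−c + √(c² + 4ε))/2)²` with `c = M√(2/λ)`, where the per-label functions `g y`
are λ-strongly convex and M-Lipschitz on the nonempty compact convex set `A`,
`p C = − max_{μ ∈ Δ_C} min_{α ∈ A} Σ_{y∈C} μ(y)·g y α`, and `(ᾱ, μ̄)` is a saddle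
point of `J_C(α, μ) = Σ_{y∈C} μ(y)·g y α` on `A × Δ_C`. -/
theorem cutting_plane_objective_decrease
    {n : ℕ} (A : Set (EuclideanSpace ℝ (Fin n))) (hA : A.Nonempty)
    (hAcomp : IsCompact A) (hAconv : Convex ℝ A)
    (lam M ε : ℝ) (hlam : 0 < lam) (hM : 0 ≤ M) (hε : 0 < ε)
    {I : Type*} [DecidableEq I] (g : I → EuclideanSpace ℝ (Fin n) → ℝ)
    (hsc : ∀ y : I, ∀ x ∈ A, ∀ x' ∈ A, ∀ t : ℝ, 0 ≤ t → t ≤ 1 →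
      g y (t • x + (1 - t) • x') ≤
        t * g y x + (1 - t) * g y x' - lam / 2 * t * (1 - t) * ‖x - x'‖ ^ 2)
    (hlip : ∀ y : I, ∀ x ∈ A, ∀ x' ∈ A, |g y x - g y x'| ≤ M * ‖x - x'‖)
    (p : Finset I → ℝ)
    (hp : ∀ C : Finset I, p C =
      -sSup {v : ℝ | ∃ μ : I → ℝ, (∀ y ∈ C, 0 ≤ μ y) ∧ (∑ y ∈ C, μ y) = 1 ∧
        v = sInf ((fun α => ∑ y ∈ C, μ y * g y α) '' A)})
    (C : Finset I) (hC : C.Nonempty)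
    (αbar : EuclideanSpace ℝ (Fin n)) (hαbar : αbar ∈ A)
    (μbar : I → ℝ) (hμbar0 : ∀ y ∈ C, 0 ≤ μbar y) (hμbar1 : (∑ y ∈ C, μbar y) = 1)
    (hsaddle₁ : ∀ α ∈ A, (∑ y ∈ C, μbar y * g y αbar) ≤ ∑ y ∈ C, μbar y * g y α)
    (hsaddle₂ : ∀ μ : I → ℝ, (∀ y ∈ C, 0 ≤ μ y) → (∑ y ∈ C, μ y) = 1 →
      (∑ y ∈ C, μ y * g y αbar) ≤ ∑ y ∈ C, μbar y * g y αbar)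
    (y₀ : I)
    (hviol : C.sup' hC (fun y => g y αbar) + ε ≤ g y₀ αbar) :
    p (insert y₀ C) ≤ p C -
      ((-(M * Real.sqrt (2 / lam)) +
          Real.sqrt ((M * Real.sqrt (2 / lam)) ^ 2 + 4 * ε)) / 2) ^ 2 := by
  have hcont : ∀ y, ContinuousOn (g y) A := by
    intro y
    have hL : LipschitzOnWith ⟨M, hM⟩ (g y) A := by
      apply LipschitzOnWith.of_dist_le_mul
      intro x hx x' hx'
      rw [Real.dist_eq, dist_eq_norm]
      exact hlip y x hx x' hx'
    exact hL.continuousOn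
  have hbdd : ∀ (D : Finset I) (μ : I → ℝ),
      BddBelow ((fun α => ∑ y ∈ D, μ y * g y α) '' A) := by
    intro D μ
    apply hAcomp.bddBelow_image
    exact continuousOn_finsetSum D (fun y _ => continuousOn_const.mul (hcont y))
  have hgC : ∀ y ∈ C, g y αbar + ε ≤ g y₀ αbar := by
    intro y hy
    have := Finset.le_sup' (fun y => g y αbar) hy
    linarith
  have hy₀ : y₀ ∉ C := fun h => by linarith [hgC y₀ h]
  obtain ⟨V, hV⟩ : ∃ V, V = ∑ y ∈ C, μbar y * g y αbar := ⟨_, rfl⟩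
  rw [← hV] at hsaddle₁ hsaddle₂
  have hVε : V + ε ≤ g y₀ αbar := by
    have h : ∑ y ∈ C, μbar y * g y αbar ≤ ∑ y ∈ C, μbar y * (g y₀ αbar - ε) :=
      Finset.sum_le_sum fun y hy =>
        mul_le_mul_of_nonneg_left (by linarith [hgC y hy]) (hμbar0 y hy)
    rw [← Finset.sum_mul, hμbar1, ← hV] at h
    linarith
  have hpC : -V ≤ p C := by
    rw [hp C]
    apply neg_le_neg
    refine csSup_le ⟨sInf ((fun α => ∑ y ∈ C, μbar y * g y α) '' A), μbar, hμbar0, hμbar1, rfl⟩ ?_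
    rintro v ⟨μ, h0, h1, rfl⟩
    exact (csInf_le (hbdd C μ) ⟨αbar, hαbar, rfl⟩).trans (hsaddle₂ μ h0 h1)
  -- quadratic growth
  have hgrow : ∀ α ∈ A, V + lam / 2 * ‖α - αbar‖ ^ 2 ≤ ∑ y ∈ C, μbar y * g y α := by
    intro α hα
    obtain ⟨F, hF⟩ : ∃ F, F = ∑ y ∈ C, μbar y * g y α := ⟨_, rfl⟩
    obtain ⟨Q, hQ⟩ : ∃ Q, Q = lam / 2 * ‖α - αbar‖ ^ 2 := ⟨_, rfl⟩
    rw [← hF, ← hQ]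
    have hQ0 : 0 ≤ Q := by rw [hQ]; positivity
    have key : ∀ t : ℝ, 0 < t → t ≤ 1 → (1 - t) * Q ≤ F - V := by
      intro t ht ht1
      have hm : t • α + (1 - t) • αbar ∈ A :=
        hAconv hα hαbar ht.le (by linarith) (by ring)
      have h1 := hsaddle₁ _ hm
      have h2 : ∑ y ∈ C, μbar y * g y (t • α + (1 - t) • αbar) ≤
          ∑ y ∈ C, (t * (μbar y * g y α) + (1 - t) * (μbar y * g y αbar)
            - μbar y * (t * (1 - t) * Q)) := by
        apply Finset.sum_le_sum
        intro y hy
        have h3 := mul_le_mul_of_nonneg_left (hsc y α hα αbar hαbar t ht.le ht1) (hμbar0 y hy)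
        rw [hQ]
        linarith
      rw [Finset.sum_sub_distrib, Finset.sum_add_distrib, ← Finset.mul_sum, ← Finset.mul_sum,
        ← Finset.sum_mul, hμbar1, ← hF, ← hV] at h2
      have h4 : t * ((1 - t) * Q) ≤ t * (F - V) := by linarith
      exact le_of_mul_le_mul_left h4 ht
    by_contra hlt
    push Not at hlt
    have hF0 := key 1 one_pos le_rfl
    have hQpos : 0 < Q := by linarith
    have h5 := key ((V + Q - F) / (2 * Q)) (by apply div_pos <;> linarith)
      (by rw [div_le_one (by linarith)]; linarith)
    have h6 : (1 - (V + Q - F) / (2 * Q)) * Q = Q - (V + Q - F) / 2 := by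
      field_simp
    linarith
  -- scalars
  obtain ⟨k, hk⟩ : ∃ k, k = Real.sqrt (2 / lam) := ⟨_, rfl⟩
  have hkpos : 0 < k := by rw [hk]; positivity
  have hk2 : k ^ 2 * lam = 2 := by
    rw [hk, Real.sq_sqrt (by positivity)]; field_simp
  rw [← hk]
  obtain ⟨c, hc⟩ : ∃ c, c = M * k := ⟨_, rfl⟩
  have hc0 : 0 ≤ c := by rw [hc]; positivity
  rw [← hc]
  obtain ⟨u, hu⟩ : ∃ u, u = (-c + Real.sqrt (c ^ 2 + 4 * ε)) / 2 := ⟨_, rfl⟩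
  rw [← hu]
  have hsq : Real.sqrt (c ^ 2 + 4 * ε) ^ 2 = c ^ 2 + 4 * ε := Real.sq_sqrt (by positivity)
  have hupos : 0 < u := by
    have : c < Real.sqrt (c ^ 2 + 4 * ε) := Real.lt_sqrt_of_sq_lt (by linarith)
    rw [hu]; linarith
  have hueq : u ^ 2 + c * u = ε := by
    rw [hu]; linear_combination hsq / 4
  have hden : 0 < 2 * u + c := by linarith
  obtain ⟨s, hs⟩ : ∃ s, s = 2 * u / (2 * u + c) := ⟨_, rfl⟩
  have hs0 : 0 ≤ s := by rw [hs]; positivity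
  have hsd : s * (2 * u + c) = 2 * u := by rw [hs]; field_simp
  have hs1 : s ≤ 1 := by rw [hs, div_le_one hden]; linarith
  have hmain : V + u ^ 2 ≤ -p (insert y₀ C) := by
    rw [hp, neg_neg]
    have hsum : ∀ f : I → ℝ, ∑ y ∈ insert y₀ C, (if y = y₀ then s else (1 - s) * μbar y) * f y
        = s * f y₀ + (1 - s) * ∑ y ∈ C, μbar y * f y := by
      intro f
      rw [Finset.sum_insert hy₀, if_pos rfl, Finset.mul_sum]
      congr 1
      apply Finset.sum_congr rfl
      intro y hy
      have hne : y ≠ y₀ := fun h => hy₀ (h ▸ hy)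
      rw [if_neg hne, mul_assoc]
    apply le_csSup_of_le (b := sInf ((fun α => ∑ y ∈ insert y₀ C,
      (if y = y₀ then s else (1 - s) * μbar y) * g y α) '' A))
    · refine ⟨g y₀ αbar, ?_⟩
      rintro v ⟨μ, h0, h1, rfl⟩
      refine (csInf_le (hbdd _ μ) ⟨αbar, hαbar, rfl⟩).trans ?_
      calc ∑ y ∈ insert y₀ C, μ y * g y αbar
          ≤ ∑ y ∈ insert y₀ C, μ y * g y₀ αbar := by
            apply Finset.sum_le_sum
            intro y hy
            apply mul_le_mul_of_nonneg_left _ (h0 y hy)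
            rcases Finset.mem_insert.1 hy with h | h
            · rw [h]
            · linarith [hgC y h]
        _ = g y₀ αbar := by rw [← Finset.sum_mul, h1, one_mul]
    · refine ⟨fun y => if y = y₀ then s else (1 - s) * μbar y, ?_, ?_, rfl⟩
      · intro y hy
        dsimp only
        split_ifs with h
        · exact hs0
        · exact mul_nonneg (by linarith) (hμbar0 y (Finset.mem_of_mem_insert_of_ne hy h))
      · have := hsum (fun _ => 1)
        simp only [mul_one, hμbar1] at this
        rw [this]; ring
    · apply le_csInf (hA.image _)
      rintro _ ⟨α, hα, rfl⟩
      dsimp only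
      rw [hsum (fun y => g y α)]
      have h1 := hgrow α hα
      have h2 := (abs_le.1 (hlip y₀ α hα αbar hαbar)).1
      obtain ⟨w, hw⟩ : ∃ w, w = ‖α - αbar‖ / k := ⟨_, rfl⟩
      have hr : ‖α - αbar‖ = k * w := by rw [hw]; field_simp
      rw [hr] at h1 h2
      have h1' : V + w ^ 2 ≤ ∑ y ∈ C, μbar y * g y α := by
        have : lam / 2 * (k * w) ^ 2 = w ^ 2 := by linear_combination w ^ 2 / 2 * hk2
        linarith
      have h2' : V + ε - c * w ≤ g y₀ α := by
        rw [hc]; linarith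
      have h3 := mul_le_mul_of_nonneg_left h1' (sub_nonneg.2 hs1)
      have h4 := mul_le_mul_of_nonneg_left h2' hs0
      have h5 : s * (ε - c * w) + (1 - s) * w ^ 2 - u ^ 2 = (1 - s) * (w - u) ^ 2 := by
        rw [← hueq]
        linear_combination (u - w) * hsd
      have h6 : 0 ≤ (1 - s) * (w - u) ^ 2 := mul_nonneg (by linarith) (sq_nonneg _)
      linarith
  linarith
end

section
/- Let H be a positive semidefinite N×N real matrix, let B be a set of vectors in ℝ^N, let v ∈ B, and let u ∈ B satisfy y'Hv ≤ u'Hv for all y ∈ B (i.e., u maximizes y ↦ y'Hv over B). If u'Hv ≠ v'Hv, then u'Hu > v'Hv. (This is Proposition 4 of the paper: the maximizer u is a violated label assignment whenever u'Hv differs from v'Hv.) -/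
/-- Proposition 4: if `u` maximizes `y ↦ y'Hv` over `B` (with `H` psd and `v ∈ B`)
and `u'Hv ≠ v'Hv`, then `u'Hu > v'Hv`, i.e. `u` is a violated label assignment. -/
theorem violated_label_assignment
    {N : ℕ} (H : Matrix (Fin N) (Fin N) ℝ) (hH : H.PosSemidef)
    (B : Set (Fin N → ℝ)) (v : Fin N → ℝ) (hv : v ∈ B)
    (u : Fin N → ℝ) (hu : u ∈ B)
    (hmax : ∀ y ∈ B, (∑ i, ∑ j, y i * H i j * v j) ≤ ∑ i, ∑ j, u i * H i j * v j)
    (hne : (∑ i, ∑ j, u i * H i j * v j) ≠ ∑ i, ∑ j, v i * H i j * v j) :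
    (∑ i, ∑ j, v i * H i j * v j) < ∑ i, ∑ j, u i * H i j * u j := by
  have hlt := lt_of_le_of_ne (hmax v hv) (Ne.symm hne)
  have hsym : ∀ i j, H i j = H j i := fun i j => by
    simpa using hH.isHermitian.apply j i
  have hcomm : (∑ i, ∑ j, v i * H i j * u j) = ∑ i, ∑ j, u i * H i j * v j := by
    rw [Finset.sum_comm]
    refine Finset.sum_congr rfl fun i _ => Finset.sum_congr rfl fun j _ => ?_
    rw [hsym j i]
    ring
  have hnn : 0 ≤ ∑ i, ∑ j, (u i - v i) * H i j * (u j - v j) := by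
    have h := hH.dotProduct_mulVec_nonneg (u - v)
    simpa [dotProduct, Matrix.mulVec, Finset.mul_sum, mul_assoc] using h
  have hexp : (∑ i, ∑ j, (u i - v i) * H i j * (u j - v j)) =
      (∑ i, ∑ j, u i * H i j * u j) - (∑ i, ∑ j, u i * H i j * v j)
      - (∑ i, ∑ j, v i * H i j * u j) + ∑ i, ∑ j, v i * H i j * v j := by
    simp only [← Finset.sum_sub_distrib, ← Finset.sum_add_distrib]
    refine Finset.sum_congr rfl fun i _ => Finset.sum_congr rfl fun j _ => ?_
    ring
  linarith
end

section
/- Let n ≥ 1, r ∈ ℝ^n, and c ∈ ℝ. Suppose ŷ maximizes the linear objective y ↦ Σ_{i=1}^n r_i y_i over the set {y ∈ {−1,1}^n : Σ_{i=1}^n y_i = c}. Then for all indices i, j: if r_i > r_j then ŷ_i ≥ ŷ_j. (This is Proposition 5 of the paper: at optimality of the balance-constrained linear integer program, the label assignment is aligned with the sorted order of r.) -/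
/-- Proposition 5: at optimality of the balance-constrained linear integer program
`max { Σ r i * y i : y ∈ {-1,1}^n, Σ y i = c }`, the label assignment is aligned
with the sorted order of `r`. -/
theorem optimal_labels_sorted
    {n : ℕ} (hn : 1 ≤ n) (r : Fin n → ℝ) (c : ℝ) (yhat : Fin n → ℝ)
    (hyhat : ∀ i, yhat i = 1 ∨ yhat i = -1) (hbal : ∑ i, yhat i = c)
    (hopt : ∀ y : Fin n → ℝ, (∀ i, y i = 1 ∨ y i = -1) → (∑ i, y i = c) →
      (∑ i, r i * y i) ≤ ∑ i, r i * yhat i) :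
    ∀ i j : Fin n, r j < r i → yhat j ≤ yhat i := by
  intro i j hr
  have hne : i ≠ j := by
    rintro rfl
    exact lt_irrefl _ hr
  have h := hopt (fun k => yhat (Equiv.swap i j k)) (fun k => hyhat _)
    ((Equiv.sum_comp (Equiv.swap i j) yhat).trans hbal)
  have h2 : ∑ k, (r k * yhat (Equiv.swap i j k) - r k * yhat k)
      = (r i * yhat (Equiv.swap i j i) - r i * yhat i)
        + (r j * yhat (Equiv.swap i j j) - r j * yhat j) := by
    apply Fintype.sum_eq_add i j hne
    rintro k ⟨hi, hj⟩
    rw [Equiv.swap_apply_of_ne_of_ne hi hj, sub_self]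
  rw [Finset.sum_sub_distrib, Equiv.swap_apply_left, Equiv.swap_apply_right] at h2
  by_contra! hlt
  have h3 := mul_pos (sub_pos.2 hr) (sub_pos.2 hlt)
  nlinarith
end

section
/- Let n ≥ 1, r ∈ ℝ^n, and β ≥ 0. Suppose ŷ maximizes the linear objective y ↦ Σ_{i=1}^n r_i y_i over the set {y ∈ {−1,1}^n : −β ≤ Σ_{i=1}^n y_i ≤ β}. Then for all indices i, j: if r_i > r_j then ŷ_i ≥ ŷ_j. (This is the clustering analogue of Proposition 5: at optimality of the linear integer program with the two-sided class-balance constraint, the label assignment is aligned with the sorted order of r, so the optimal assignment can be found by sorting.) -/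
/-- Clustering analogue of Proposition 5: at optimality of the linear integer program
`max { Σ r i * y i : y ∈ {-1,1}^n, -β ≤ Σ y i ≤ β }`, the label assignment is aligned
with the sorted order of `r`. -/
theorem optimal_labels_sorted_two_sided_balance
    {n : ℕ} (hn : 1 ≤ n) (r : Fin n → ℝ) (β : ℝ) (hβ : 0 ≤ β) (yhat : Fin n → ℝ)
    (hyhat : ∀ i, yhat i = 1 ∨ yhat i = -1)
    (hbal : -β ≤ ∑ i, yhat i) (hbal' : ∑ i, yhat i ≤ β)
    (hopt : ∀ y : Fin n → ℝ, (∀ i, y i = 1 ∨ y i = -1) →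
      (-β ≤ ∑ i, y i) → (∑ i, y i ≤ β) →
      (∑ i, r i * y i) ≤ ∑ i, r i * yhat i) :
    ∀ i j : Fin n, r j < r i → yhat j ≤ yhat i := by
  intro i j hr
  by_contra hlt
  push Not at hlt
  have hne : i ≠ j := by
    rintro rfl
    exact lt_irrefl _ hr
  have hs : ∑ k, yhat (Equiv.swap i j k) = ∑ k, yhat k := Equiv.sum_comp (Equiv.swap i j) yhat
  have h := hopt (fun k => yhat (Equiv.swap i j k)) (fun k => hyhat _)
    (by rw [hs]; exact hbal) (by rw [hs]; exact hbal')
  have hd : ∑ k, (r k * yhat (Equiv.swap i j k) - r k * yhat k)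
      = (r i * yhat j - r i * yhat i) + (r j * yhat i - r j * yhat j) := by
    rw [Fintype.sum_eq_add i j hne]
    · simp
    · rintro k ⟨h1, h2⟩
      rw [Equiv.swap_apply_of_ne_of_ne h1 h2, sub_self]
  rw [Finset.sum_sub_distrib] at hd
  nlinarith [mul_pos (sub_pos.2 hr) (sub_pos.2 hlt)]
end
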